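/- arXiv:1207.2864 — 2 statements merged into one kernel-verified Lean document; each statement's English description precedes it below -/
import Mathlib

section
/- Let A be a positive bounded linear operator on a complex Hilbert space H and let 0 < r < 1. Then A^r = (sin(rπ)/π) · ∫₀^∞ λ^{r-1} · A(λ·I + A)⁻¹ dλ, where the integral converges as a Bochner integral in B(H). -/
open MeasureTheory Real

open Set in
lemma integral_rpowIntegrand_one_eq (r : ℝ) (hr0 : 0 < r) (hr1 : r < 1) :
    ∫ t in Ioi 0, Real.rpowIntegrand₀₁ r t 1 = π / Real.sin (π * r) := by
  have himg : (fun u : ℝ => u / (1 - u)) '' Ioo 0 1 = Ioi 0 := by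
    ext t
    constructor
    · rintro ⟨u, ⟨hu0, hu1⟩, rfl⟩
      exact div_pos hu0 (by linarith)
    · intro ht
      have ht : 0 < t := ht
      refine ⟨t / (1 + t), ⟨by positivity, ?_⟩, ?_⟩
      · rw [div_lt_one (by positivity)]; linarith
      · have : 1 + t ≠ 0 := by positivity
        have h2 : 1 - t / (1 + t) = 1 / (1 + t) := by field_simp; ring
        simp only [h2]
        field_simp
  have hinj : InjOn (fun u : ℝ => u / (1 - u)) (Ioo 0 1) := by
    intro u hu v hv huv
    have h1 : 1 - u ≠ 0 := by linarith [hu.2]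
    have h2 : 1 - v ≠ 0 := by linarith [hv.2]
    simp only at huv
    rw [div_eq_div_iff h1 h2] at huv
    linarith
  have hder : ∀ u ∈ Ioo (0:ℝ) 1,
      HasDerivWithinAt (fun u : ℝ => u / (1 - u)) (1 / (1 - u) ^ 2) (Ioo 0 1) u := by
    intro u hu
    have h1 : 1 - u ≠ 0 := by linarith [hu.2]
    have := (hasDerivAt_id u).div ((hasDerivAt_id u).const_sub 1) h1
    refine (HasDerivAt.congr_deriv this ?_).hasDerivWithinAt
    simp
  rw [← himg, integral_image_eq_integral_abs_deriv_smul measurableSet_Ioo hder hinj]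
  have key : ∀ u ∈ Ioo (0:ℝ) 1, |1 / (1 - u) ^ 2| • Real.rpowIntegrand₀₁ r (u / (1 - u)) 1
      = u ^ (r - 1) * (1 - u) ^ ((1 - r) - 1) := by
    intro u hu
    have hu0 : 0 < u := hu.1
    have h1 : 0 < 1 - u := by linarith [hu.2]
    rw [Real.rpowIntegrand₀₁_eq_pow_div ⟨hr0, hr1⟩ (by positivity) zero_le_one,
      abs_of_pos (by positivity), smul_eq_mul, Real.div_rpow hu0.le h1.le]
    have e1 : u / (1 - u) + 1 = 1 / (1 - u) := by field_simp; ring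
    have e2 : (1 - u) ^ ((1 - r) - 1) = ((1 - u) ^ (r - 1))⁻¹ * (1 - u)⁻¹ := by
      rw [← Real.rpow_neg h1.le, ← Real.rpow_neg_one (1 - u), ← Real.rpow_add h1]
      congr 1; ring
    rw [e1, e2]
    have : (1 - u) ^ (r - 1) ≠ 0 := by positivity
    field_simp
  rw [setIntegral_congr_fun measurableSet_Ioo key]
  have hb : Complex.betaIntegral r ((1 - r : ℝ) : ℂ) =
      ((∫ u in Ioo (0:ℝ) 1, u ^ (r - 1) * (1 - u) ^ ((1 - r) - 1) : ℝ) : ℂ) := by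
    rw [Complex.betaIntegral, intervalIntegral.integral_of_le zero_le_one,
      integral_Ioc_eq_integral_Ioo, ← integral_complex_ofReal]
    refine setIntegral_congr_fun measurableSet_Ioo fun u hu => ?_
    have h1 : 0 ≤ 1 - u := by linarith [hu.2]
    push_cast [Complex.ofReal_cpow hu.1.le, Complex.ofReal_cpow h1]
    rfl
  have h := ProbabilityTheory.beta_eq_betaIntegralReal r (1 - r) hr0 (by linarith)
  rw [hb, Complex.ofReal_re] at h
  rw [← h, ProbabilityTheory.beta, Real.Gamma_mul_Gamma_one_sub]
  simp

/-- For a positive operator `A` on a complex Hilbert space and `0 < r < 1`, the function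
`λ ↦ λ^{r-1} · A(λ·I + A)⁻¹` is Bochner integrable on `(0, ∞)` and
`A^r = (sin(rπ)/π) · ∫₀^∞ λ^{r-1} · A(λ·I + A)⁻¹ dλ`. -/
theorem rpow_operator_eq_integral_representation
    {H : Type*} [NormedAddCommGroup H] [InnerProductSpace ℂ H] [CompleteSpace H]
    (A : H →L[ℂ] H) (hA : 0 ≤ A) (r : ℝ) (hr0 : 0 < r) (hr1 : r < 1) :
    IntegrableOn
      (fun l : ℝ => l ^ (r - 1) • (A * Ring.inverse (l • (1 : H →L[ℂ] H) + A)))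
      (Set.Ioi 0) volume ∧
    CFC.rpow A r = (Real.sin (r * π) / π) •
      ∫ l in Set.Ioi (0 : ℝ),
        l ^ (r - 1) • (A * Ring.inverse (l • (1 : H →L[ℂ] H) + A)) := by
  have hp : r ∈ Set.Ioo (0:ℝ) 1 := ⟨hr0, hr1⟩
  have hsa : IsSelfAdjoint A := hA.isSelfAdjoint
  have hspec : ∀ z ∈ spectrum ℝ A, 0 ≤ z := fun z hz => spectrum_nonneg_of_nonneg hA hz
  have hEq : Set.EqOn (fun l : ℝ => cfc (Real.rpowIntegrand₀₁ r l) A)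
      (fun l : ℝ => l ^ (r - 1) • (A * Ring.inverse (l • (1 : H →L[ℂ] H) + A)))
      (Set.Ioi 0) := by
    intro l hl
    have hl : 0 < l := hl
    have hne : ∀ z ∈ spectrum ℝ A, l + z ≠ 0 := fun z hz => by
      have := hspec z hz; positivity
    have hc : ContinuousOn (fun z : ℝ => (l + z)⁻¹) (spectrum ℝ A) :=
      ContinuousOn.inv₀ (by fun_prop) hne
    have h1 : cfc (Real.rpowIntegrand₀₁ r l) A
        = cfc (fun z : ℝ => l ^ (r - 1) * (z * (l + z)⁻¹)) A := by
      refine cfc_congr fun z hz => ?_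
      simp only [Real.rpowIntegrand₀₁_eq_pow_div hp hl.le (hspec z hz)]
      rw [div_eq_mul_inv, mul_assoc]
    simp only
    rw [h1, cfc_const_mul _ _ A (by fun_prop), cfc_mul (fun z : ℝ => z) _ A (by fun_prop) hc,
      cfc_inv _ A hne, cfc_const_add .., cfc_id' .., Algebra.algebraMap_eq_smul_one]
  let M : ℝ := ‖A‖ * ‖(1 : H →L[ℂ] H)‖
  have hM : 0 ≤ M := by positivity
  have hf : ContinuousOn (Function.uncurry (Real.rpowIntegrand₀₁ r))
      (Set.Ioi (0 : ℝ) ×ˢ spectrum ℝ A) :=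
    Real.continuousOn_rpowIntegrand₀₁_uncurry hp _ hspec
  have hbound : ∀ᵐ t ∂(volume.restrict (Set.Ioi (0:ℝ))), ∀ z ∈ spectrum ℝ A,
      ‖Real.rpowIntegrand₀₁ r t z‖ ≤ Real.rpowIntegrand₀₁ r t M := by
    filter_upwards [ae_restrict_mem measurableSet_Ioi] with t ht z hz
    have ht : 0 < t := ht
    rw [Real.norm_of_nonneg (Real.rpowIntegrand₀₁_nonneg hr0 ht.le (hspec z hz))]
    refine Real.rpowIntegrand₀₁_monotoneOn hp ht.le (hspec z hz) hM ?_
    exact (le_abs_self z).trans (spectrum.norm_le_norm_mul_of_mem hz)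
  have hfin := (Real.integrableOn_rpowIntegrand₀₁_Ioi hp hM).2
  refine ⟨?_, ?_⟩
  · refine IntegrableOn.congr_fun ?_ hEq measurableSet_Ioi
    exact integrableOn_cfc measurableSet_Ioi _ _ A hf hbound hfin hsa
  · rw [← setIntegral_congr_fun measurableSet_Ioi hEq,
      ← cfc_setIntegral measurableSet_Ioi _ _ A hf hbound hfin hsa,
      CFC.rpow_eq_pow, CFC.rpow_eq_cfc_real hA]
    have hpow : ContinuousOn (fun x : ℝ => x ^ r) (spectrum ℝ A) :=
      ContinuousOn.rpow_const (by fun_prop) fun _ _ => Or.inr hr0.le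
    have hs : 0 < Real.sin (π * r) :=
      Real.sin_pos_of_pos_of_lt_pi (by positivity) (by nlinarith [Real.pi_pos])
    have h2 : cfc (fun z : ℝ => ∫ t in Set.Ioi 0, Real.rpowIntegrand₀₁ r t z) A
        = (π / Real.sin (π * r)) • cfc (fun x : ℝ => x ^ r) A := by
      rw [← cfc_const_mul _ _ A hpow]
      refine cfc_congr fun z hz => ?_
      simp only [Real.integral_rpowIntegrand₀₁_eq_rpow_mul_const hp (hspec z hz),
        integral_rpowIntegrand_one_eq r hr0 hr1, mul_comm]
    rw [h2, smul_smul, mul_comm r π]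
    have : Real.sin (π * r) / π * (π / Real.sin (π * r)) = 1 := by
      have := hs.ne'
      field_simp
    rw [this, one_smul]
end

section
/- Let A and B be positive bounded linear operators on a complex Hilbert space H and let m > 0 be a real number such that A - B ≥ m·I. Then for every r with 0 < r ≤ 1, A^r - B^r ≥ (‖A‖^r - (‖A‖ - m)^r)·I. -/
/-- The increment `t ^ r - (t - m) ^ r` is antitone. -/
theorem rpow_increment_aux (m r t N : ℝ) (hm : 0 < m) (hr0 : 0 < r) (hr1 : r ≤ 1)
    (hmt : m ≤ t) (htN : t ≤ N) : N ^ r - (N - m) ^ r ≤ t ^ r - (t - m) ^ r := by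
  have hc := Real.concaveOn_rpow hr0.le hr1
  have hs : 0 < m + (N - t) := by linarith
  have ha : (t - m) ∈ Set.Ici (0 : ℝ) := by simpa using hmt
  have hN : N ∈ Set.Ici (0 : ℝ) := by simp; linarith
  have hu : 0 ≤ (N - t) / (m + (N - t)) := div_nonneg (by linarith) hs.le
  have hv : 0 ≤ m / (m + (N - t)) := div_nonneg hm.le hs.le
  have huv : (N - t) / (m + (N - t)) + m / (m + (N - t)) = 1 := by field_simp; ring
  have h1 := hc.2 ha hN hu hv huv
  have h2 := hc.2 ha hN hv hu (by rw [add_comm]; exact huv)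
  have e1 : (N - t) / (m + (N - t)) * (t - m) + m / (m + (N - t)) * N = t := by
    field_simp; ring
  have e2 : m / (m + (N - t)) * (t - m) + (N - t) / (m + (N - t)) * N = N - m := by
    field_simp; ring
  simp only [smul_eq_mul] at h1 h2
  rw [e1] at h1
  rw [e2] at h2
  generalize (N - t) / (m + (N - t)) = u at *
  generalize m / (m + (N - t)) = v at *
  obtain rfl : u = 1 - v := by linarith
  linarith

/-- **Main theorem (Moslehian–Najafi).** If `A, B` are positive operators on a complex Hilbert
space with `A - B ≥ m·I` for some `m > 0`, then for every `0 < r ≤ 1`,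
`A^r - B^r ≥ (‖A‖^r - (‖A‖ - m)^r)·I`. -/
theorem rpow_sub_rpow_ge_of_sub_ge_smul_one
    {H : Type*} [NormedAddCommGroup H] [InnerProductSpace ℂ H] [CompleteSpace H]
    (A B : H →L[ℂ] H) (hA : 0 ≤ A) (hB : 0 ≤ B)
    (m : ℝ) (hm : 0 < m) (h : m • (1 : H →L[ℂ] H) ≤ A - B)
    (r : ℝ) (hr0 : 0 < r) (hr1 : r ≤ 1) :
    (‖A‖ ^ r - (‖A‖ - m) ^ r) • (1 : H →L[ℂ] H) ≤ CFC.rpow A r - CFC.rpow B r := by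
  change _ ≤ A ^ r - B ^ r
  have hsa : IsSelfAdjoint A := IsSelfAdjoint.of_nonneg hA
  have hBA : B ≤ A - m • (1 : H →L[ℂ] H) := by
    rw [le_sub_iff_add_le] at h ⊢
    rwa [add_comm]
  have hC : 0 ≤ A - m • (1 : H →L[ℂ] H) := hB.trans hBA
  have hmono : B ^ r ≤ (A - m • (1 : H →L[ℂ] H)) ^ r :=
    CFC.rpow_le_rpow ⟨hr0.le, hr1⟩ hBA
  have hmA : algebraMap ℝ (H →L[ℂ] H) m ≤ A := by
    rw [Algebra.algebraMap_eq_smul_one]; exact sub_nonneg.mp hC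
  have hspec : ∀ t ∈ spectrum ℝ A, m ≤ t := (algebraMap_le_iff_le_spectrum hsa).mp hmA
  have hspec2 : ∀ t ∈ spectrum ℝ A, t ≤ ‖A‖ :=
    (le_algebraMap_iff_spectrum_le hsa).mp (IsSelfAdjoint.le_algebraMap_norm_self hsa)
  have hcont : Continuous (fun t : ℝ => t ^ r) := Real.continuous_rpow_const hr0.le
  have hcont2 : Continuous (fun t : ℝ => (t - m) ^ r) := hcont.comp (continuous_sub_right m)
  have e0 : A - m • (1 : H →L[ℂ] H) = cfc (fun t : ℝ => t - m) A := by
    rw [cfc_sub (fun t : ℝ => t) (fun _ => m) A, cfc_id' ℝ A, cfc_const m A,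
      Algebra.algebraMap_eq_smul_one]
  have e1 : (A - m • (1 : H →L[ℂ] H)) ^ r = cfc (fun t : ℝ => (t - m) ^ r) A := by
    rw [CFC.rpow_eq_cfc_real hC, e0]
    exact (cfc_comp' (fun t : ℝ => t ^ r) (fun t : ℝ => t - m) A hcont.continuousOn).symm
  have key : (‖A‖ ^ r - (‖A‖ - m) ^ r) • (1 : H →L[ℂ] H)
      ≤ A ^ r - (A - m • (1 : H →L[ℂ] H)) ^ r := by
    rw [e1, CFC.rpow_eq_cfc_real hA, ← cfc_sub _ _ A hcont.continuousOn hcont2.continuousOn,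
      ← Algebra.algebraMap_eq_smul_one]
    rw [algebraMap_le_cfc_iff (fun x : ℝ => x ^ r - (x - m) ^ r) _ A (hcont.sub hcont2).continuousOn]
    exact fun t ht => rpow_increment_aux m r t ‖A‖ hm hr0 hr1 (hspec t ht) (hspec2 t ht)
  exact key.trans (sub_le_sub_left hmono _)
end
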